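/- Let H ∈ (0,1/2), let (Ω,F,P) be a probability space, and let X¹, X² : ℝ → Ω → ℝ be two independent centered Gaussian processes, each with covariance C_H. Let f ∈ C_b^∞(ℝ²), let p ≥ 0 be an even natural number and q ≥ 1 an odd natural number, and fix t ≥ 0. Then there exists a constant C > 0, depending only on f, H, p, q (not on n or t), such that for all integers n ≥ 1: E[(V_n^{p,q}(f,t))²] ≤ C · Σ_{k'=1}^{(q+1)/2} [ (Σ_{a=1}^{2k'−1} 2^{−n(H(p+q+2k'−1−a) − 1/2)})·t + 2^{−n(H(p+q+2k'−2) − 1/2)}·t^{2H+1} + 2^{−nH(p+q+2k'−1)} ]. -/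

import Mathlib

open MeasureTheory ProbabilityTheory Filter

noncomputable section

/-- Covariance function of the (two-sided) fractional Brownian motion with Hurst index `H`:
`C_H(t,s) = (|t|^{2H} + |s|^{2H} − |t−s|^{2H})/2`. -/
def covH (H t s : ℝ) : ℝ :=
  (|t| ^ (2 * H) + |s| ^ (2 * H) - |t - s| ^ (2 * H)) / 2

/-- `ρ_H(k) = (1/2)(|k+1|^{2H} + |k−1|^{2H} − 2|k|^{2H})`. -/
def rhoH (H : ℝ) (k : ℤ) : ℝ :=
  (|(k : ℝ) + 1| ^ (2 * H) + |(k : ℝ) - 1| ^ (2 * H) - 2 * |(k : ℝ)| ^ (2 * H)) / 2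

/-- `X` is a centered Gaussian process with covariance function `C` under `P`: every finite
linear combination of values of the process is a centered real Gaussian random variable with
the appropriate variance. -/
def IsCenteredGaussianProcess {Ω : Type*} [MeasurableSpace Ω] (P : Measure Ω)
    (X : ℝ → Ω → ℝ) (C : ℝ → ℝ → ℝ) : Prop :=
  (∀ t, Measurable (X t)) ∧
  ∀ (m : ℕ) (ts : Fin m → ℝ) (c : Fin m → ℝ),
    Measure.map (fun ω => ∑ i, c i * X (ts i) ω) P =
      gaussianReal 0 (Real.toNNReal (∑ i, ∑ j, c i * c j * C (ts i) (ts j)))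

/-- The σ-algebras generated by the two processes `X1` and `X2` are independent under `P`. -/
def IndepProcesses {Ω : Type*} [MeasurableSpace Ω] (P : Measure Ω)
    (X1 X2 : ℝ → Ω → ℝ) : Prop :=
  ProbabilityTheory.Indep
    (⨆ t : ℝ, MeasurableSpace.comap (X1 t) inferInstance)
    (⨆ t : ℝ, MeasurableSpace.comap (X2 t) inferInstance) P

/-- `g` is infinitely differentiable and bounded together with all its derivatives. -/
def CbSmooth {E : Type*} [NormedAddCommGroup E] [NormedSpace ℝ E] (g : E → ℝ) : Prop :=
  (∀ n : ℕ, ContDiff ℝ n g) ∧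
  ∀ k : ℕ, ∃ M : ℝ, ∀ x : E, ‖iteratedFDeriv ℝ k g x‖ ≤ M

/-- `f : ℝ² → ℝ` (in curried form) belongs to `C_b^∞(ℝ²)`. -/
def CbSmooth2 (f : ℝ → ℝ → ℝ) : Prop :=
  CbSmooth fun p : ℝ × ℝ => f p.1 p.2

/-- Partial derivative of `f : ℝ → ℝ → ℝ`, taken `k` times in the first variable and `l` times
in the second variable. -/
def pd (k l : ℕ) (f : ℝ → ℝ → ℝ) (x y : ℝ) : ℝ :=
  iteratedDeriv k (fun u => iteratedDeriv l (fun v => f u v) y) x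

/-- The dyadic point `j·2^{−n/2}`. -/
def dyadicPt (n j : ℕ) : ℝ := (j : ℝ) * (2 : ℝ) ^ (-(n : ℝ) / 2)

/-- The number of dyadic steps `⌊2^{n/2} t⌋`. -/
def nSteps (n : ℕ) (t : ℝ) : ℕ := Nat.floor ((2 : ℝ) ^ ((n : ℝ) / 2) * t)

variable {Ω : Type*}

/-- The increment `X_{(j+1)2^{−n/2}} − X_{j2^{−n/2}}` of the process `X`. -/
def Xincr (X : ℝ → Ω → ℝ) (n j : ℕ) (ω : Ω) : ℝ :=
  X (dyadicPt n (j + 1)) ω - X (dyadicPt n j) ω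

/-- The midpoint evaluation `Δ_{j,n} g(X¹,X²)`. -/
def Xmid (X1 X2 : ℝ → Ω → ℝ) (g : ℝ → ℝ → ℝ) (n j : ℕ) (ω : Ω) : ℝ :=
  g ((X1 (dyadicPt n (j + 1)) ω + X1 (dyadicPt n j) ω) / 2)
    ((X2 (dyadicPt n (j + 1)) ω + X2 (dyadicPt n j) ω) / 2)

lemma gaussianPDFReal_std_hasDerivAt (u : ℝ) :
    HasDerivAt (gaussianPDFReal 0 1) (-u * gaussianPDFReal 0 1 u) u := by
  have h1 : HasDerivAt (fun x : ℝ => -(x - 0) ^ 2 / (2 * ((1 : NNReal) : ℝ))) (-u) u := by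
    have := (((hasDerivAt_id u).sub_const 0).pow 2).neg.div_const (2 * ((1 : NNReal) : ℝ))
    convert! this using 1
    simp
    ring
  have h2 := h1.exp.const_mul (√(2 * Real.pi * ((1 : NNReal) : ℝ)))⁻¹
  rw [gaussianPDFReal_def]
  convert! h2 using 1
  ring

/-- Stein's identity for the standard Gaussian law. -/
lemma integral_id_mul_gaussianReal {ψ ψ' : ℝ → ℝ} (hd : ∀ u, HasDerivAt ψ (ψ' u) u)
    (h0 : Integrable ψ (gaussianReal 0 1)) (h1 : Integrable (fun u => u * ψ u) (gaussianReal 0 1))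
    (h2 : Integrable ψ' (gaussianReal 0 1)) :
    ∫ u, u * ψ u ∂(gaussianReal 0 1) = ∫ u, ψ' u ∂(gaussianReal 0 1) := by
  have key : ∀ φ : ℝ → ℝ, Integrable φ (gaussianReal 0 1) →
      Integrable (fun u => gaussianPDFReal 0 1 u * φ u) := by
    intro φ hφ
    rw [gaussianReal_of_var_ne_zero _ one_ne_zero,
      integrable_withDensity_iff_integrable_smul' (measurable_gaussianPDF _ _)
        (Eventually.of_forall fun _ => gaussianPDF_lt_top)] at hφ
    simpa using hφ
  rw [integral_gaussianReal_eq_integral_smul one_ne_zero,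
    integral_gaussianReal_eq_integral_smul one_ne_zero, ← sub_eq_zero, ← integral_sub]
  · have hz := integral_eq_zero_of_hasDerivAt_of_integrable
      (f := fun u => gaussianPDFReal 0 1 u * ψ u)
      (f' := fun u => -u * gaussianPDFReal 0 1 u * ψ u + gaussianPDFReal 0 1 u * ψ' u)
      (fun u => (gaussianPDFReal_std_hasDerivAt u).mul (hd u))
      (((key _ h1).neg.add (key _ h2)).congr (Eventually.of_forall fun u => by
        simp only [Pi.add_apply, Pi.neg_apply]; ring)) (key _ h0)
    rw [← neg_eq_zero, ← integral_neg]
    refine Eq.trans (integral_congr_ae (Eventually.of_forall fun u => ?_)) hz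
    simp only [smul_eq_mul]
    ring
  · simpa using key _ h1
  · simpa using key _ h2

/-- A centered Gaussian variable with second moment one is standard Gaussian. -/
lemma map_eq_gaussianReal_std [MeasurableSpace Ω] {P : Measure Ω} {U : Ω → ℝ}
    (hU : HasGaussianLaw U P) (hm : ∫ ω, U ω ∂P = 0) (hv : ∫ ω, U ω * U ω ∂P = 1) :
    P.map U = gaussianReal 0 1 := by
  have : IsProbabilityMeasure P := hU.isProbabilityMeasure
  have h2 : ∫ ω, U ω ^ 2 ∂P = 1 := by simpa only [sq] using hv
  rw [hU.map_eq_gaussianReal, hm, variance_eq_sub hU.memLp_two, hm]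
  simp [h2]

/-- Gaussian integration by parts in the direction of a standard coordinate `Z i` of a centered
Gaussian vector: `φ'` is the derivative of `φ` along the vector of covariances with `Z i`. -/
lemma gaussian_integration_by_parts {ι : Type*} [Fintype ι] [MeasurableSpace Ω] {P : Measure Ω}
    {Z : ι → Ω → ℝ} (hG : HasGaussianLaw (fun ω k => Z k ω) P) (hm : ∀ k, ∫ ω, Z k ω ∂P = 0)
    {i : ι} (hi : ∫ ω, Z i ω * Z i ω ∂P = 1) {φ φ' : (ι → ℝ) → ℝ}
    (hφ : Continuous φ) (hφ' : Continuous φ')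
    (hd : ∀ (w : ι → ℝ) (u : ℝ), HasDerivAt
      (fun u : ℝ => φ (w + u • fun k => ∫ ω, Z i ω * Z k ω ∂P))
      (φ' (w + u • fun k => ∫ ω, Z i ω * Z k ω ∂P)) u)
    (h0 : Integrable (fun ω => φ fun k => Z k ω) P)
    (h1 : Integrable (fun ω => Z i ω * φ fun k => Z k ω) P)
    (h2 : Integrable (fun ω => φ' fun k => Z k ω) P) :
    ∫ ω, Z i ω * φ (fun k => Z k ω) ∂P = ∫ ω, φ' (fun k => Z k ω) ∂P := by
  have : IsProbabilityMeasure P := hG.isProbabilityMeasure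
  set c : ι → ℝ := fun k => ∫ ω, Z i ω * Z k ω ∂P with hc
  have hZ2 : ∀ k, MemLp (Z k) 2 P := fun k => (hG.eval k).memLp_two
  set W : ι → Ω → ℝ := fun k ω => Z k ω - Z i ω * c k with hW
  have hpair : HasGaussianLaw (fun ω => ((fun _ : Unit => Z i ω), fun k => W k ω)) P := by
    let L : (ι → ℝ) →ₗ[ℝ] (Unit → ℝ) × (ι → ℝ) :=
      { toFun := fun z => (fun _ => z i, fun k => z k - z i * c k)
        map_add' := by
          intro x y
          ext k <;> simp
          ring
        map_smul' := by
          intro x y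
          ext k <;> simp
          ring }
    exact hG.map_fun (LinearMap.toContinuousLinearMap L)
  have hind0 := hpair.indepFun_of_covariance_eval (X := fun _ => Z i) (Y := W) (by
    intro _ k
    have hWk : MemLp (W k) 2 P := (hZ2 k).sub ((hZ2 i).mul_const _)
    rw [covariance_eq_sub (hZ2 i) hWk, hm i, zero_mul, sub_zero]
    have e : ∫ ω, (Z i ω * Z k ω - Z i ω * Z i ω * c k) ∂P =
        ∫ ω, Z i ω * Z k ω ∂P - ∫ ω, Z i ω * Z i ω * c k ∂P :=
      integral_sub ((hZ2 i).integrable_mul (hZ2 k))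
        (((hZ2 i).integrable_mul (hZ2 i)).mul_const _)
    rw [integral_mul_const, hi, one_mul, sub_self] at e
    rw [← e]
    simp only [hW, Pi.mul_apply, mul_sub, mul_assoc])
  have hind : IndepFun (fun ω k => W k ω) (Z i) P :=
    (hind0.comp (measurable_pi_apply ()) measurable_id).symm
  have hZm : AEMeasurable (Z i) P := (hG.eval i).aemeasurable
  have hWm : AEMeasurable (fun ω k => W k ω) P := hpair.snd.aemeasurable
  have hlaw := map_eq_gaussianReal_std (hG.eval i) (hm i) hi
  set μ := P.map (fun ω k => W k ω) with hμ
  have : IsProbabilityMeasure μ := Measure.isProbabilityMeasure_map hWm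
  have hmap : P.map (fun ω => ((fun k => W k ω), Z i ω)) = μ.prod (gaussianReal 0 1) := by
    rw [(indepFun_iff_map_prod_eq_prod_map_map hWm hZm).1 hind, hlaw]
  have hrec : ∀ ω, (fun k => W k ω) + Z i ω • c = fun k => Z k ω := by
    intro ω; ext k; simp [hW]
  have hpm : AEMeasurable (fun ω => ((fun k => W k ω), Z i ω)) P := hWm.prodMk hZm
  have trans : ∀ F : (ι → ℝ) × ℝ → ℝ, Continuous F →
      Integrable (fun ω => F ((fun k => W k ω), Z i ω)) P →
      Integrable F (μ.prod (gaussianReal 0 1)) ∧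
      ∫ ω, F ((fun k => W k ω), Z i ω) ∂P = ∫ w, ∫ u, F (w, u) ∂(gaussianReal 0 1) ∂μ := by
    intro F hF hFi
    have hI : Integrable F (μ.prod (gaussianReal 0 1)) := by
      rw [← hmap]
      exact (integrable_map_measure hF.aestronglyMeasurable hpm).2 hFi
    refine ⟨hI, ?_⟩
    rw [← integral_prod _ hI, ← hmap, integral_map hpm hF.aestronglyMeasurable]
  have cφ : Continuous fun x : (ι → ℝ) × ℝ => φ (x.1 + x.2 • c) := by fun_prop
  have cφ' : Continuous fun x : (ι → ℝ) × ℝ => φ' (x.1 + x.2 • c) := by fun_prop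
  obtain ⟨i0, -⟩ := trans _ cφ (by simpa only [hrec] using h0)
  obtain ⟨i1, e1⟩ := trans (fun x => x.2 * φ (x.1 + x.2 • c)) (by fun_prop)
    (by simpa only [hrec] using h1)
  obtain ⟨i2, e2⟩ := trans _ cφ' (by simpa only [hrec] using h2)
  simp only [hrec] at e1 e2
  rw [e1, e2]
  refine integral_congr_ae ?_
  filter_upwards [i0.prod_right_ae, i1.prod_right_ae, i2.prod_right_ae] with w a0 a1 a2
  exact integral_id_mul_gaussianReal (hd w) a0 a1 a2

/-- `G m` is the `m`-th derivative of `G 0`, and the derivatives up to order two are bounded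
by `K`. -/
def IsBoundedJet (K : ℝ) (G : ℕ → ℝ → ℝ) : Prop :=
  (∀ m x, HasDerivAt (G m) (G (m + 1) x) x) ∧ ∀ m ≤ 2, ∀ x, |G m x| ≤ K

lemma IsBoundedJet.continuous {K : ℝ} {G : ℕ → ℝ → ℝ} (h : IsBoundedJet K G) (m : ℕ) :
    Continuous (G m) :=
  continuous_iff_continuousAt.2 fun x => (h.1 m x).continuousAt

lemma abs_pow_mul_pow_le (x y : ℝ) (a b : ℕ) :
    |x ^ a * y ^ b| ≤ x ^ (2 * a) + y ^ (2 * b) := by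
  rw [abs_mul, pow_mul', pow_mul', ← sq_abs (x ^ a), ← sq_abs (y ^ b)]
  nlinarith [sq_nonneg (|x ^ a| - |y ^ b|), sq_nonneg (|x ^ a|), sq_nonneg (|y ^ b|)]

/-- Even moments of the standard Gaussian law. -/
def stdMoment (a : ℕ) : ℝ := ∫ x, x ^ (2 * a) ∂(gaussianReal 0 1)

lemma stdMoment_nonneg (a : ℕ) : 0 ≤ stdMoment a :=
  integral_nonneg fun x => by rw [pow_mul]; positivity

lemma stdMoment_add_mul_nonneg (K : ℝ) (a b : ℕ) : 0 ≤ (stdMoment a + stdMoment b) * K * K := by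
  rw [mul_assoc]
  exact mul_nonneg (add_nonneg (stdMoment_nonneg a) (stdMoment_nonneg b)) (mul_self_nonneg K)

lemma integrable_pow_of_hasGaussianLaw [MeasurableSpace Ω] {P : Measure Ω} {U : Ω → ℝ}
    (hU : HasGaussianLaw U P) (a : ℕ) : Integrable (fun ω => U ω ^ a) P := by
  have : IsProbabilityMeasure P := hU.isProbabilityMeasure
  have h := (hU.memLp (p := a) (by simp)).integrable_norm_pow'
  refine h.mono (hU.aemeasurable.pow_const a).aestronglyMeasurable (Eventually.of_forall ?_)
  intro ω
  simp

lemma integral_pow_eq_stdMoment [MeasurableSpace Ω] {P : Measure Ω} {U : Ω → ℝ}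
    (hU : HasGaussianLaw U P) (hm : ∫ ω, U ω ∂P = 0) (hv : ∫ ω, U ω * U ω ∂P = 1) (a : ℕ) :
    ∫ ω, U ω ^ (2 * a) ∂P = stdMoment a := by
  rw [stdMoment, ← map_eq_gaussianReal_std hU hm hv,
    integral_map hU.aemeasurable (by fun_prop)]

section MixedMoments

variable {ι : Type*}

/-- The mixed moment `E[Z_i^a Z_j^b G^{(m)}(Z_k) H^{(n)}(Z_l)]`. -/
def mixedMoment [MeasurableSpace Ω] (P : Measure Ω) (Z : ι → Ω → ℝ) (G H : ℕ → ℝ → ℝ)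
    (i j k l : ι) (a b m n : ℕ) : ℝ :=
  ∫ ω, Z i ω ^ a * Z j ω ^ b * G m (Z k ω) * H n (Z l ω) ∂P

variable [MeasurableSpace Ω] {P : Measure Ω} {Z : ι → Ω → ℝ} {G H : ℕ → ℝ → ℝ} {K : ℝ}

lemma mixedMoment_swap (i j k l : ι) (a b m n : ℕ) :
    mixedMoment P Z G H i j k l a b m n = mixedMoment P Z G H j i k l b a m n := by
  unfold mixedMoment
  simp only [mul_comm (Z i _ ^ a)]

lemma mul_bound_le {x y z K : ℝ} (hy : |y| ≤ K) (hz : |z| ≤ K) : |x * y * z| ≤ |x| * K * K := by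
  have hK : 0 ≤ K := (abs_nonneg _).trans hy
  rw [abs_mul, abs_mul]
  gcongr

lemma integrable_mixed (hG : HasGaussianLaw (fun ω k => Z k ω) P)
    (hJG : IsBoundedJet K G) (hJH : IsBoundedJet K H) (i j k l : ι) (a b : ℕ) {m n : ℕ}
    (hmm : m ≤ 2) (hn : n ≤ 2) :
    Integrable (fun ω => Z i ω ^ a * Z j ω ^ b * G m (Z k ω) * H n (Z l ω)) P := by
  have hZ := fun k => (hG.eval k).aemeasurable
  have hdom := (((integrable_pow_of_hasGaussianLaw (hG.eval i) (2 * a)).add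
    (integrable_pow_of_hasGaussianLaw (hG.eval j) (2 * b))).mul_const K).mul_const K
  refine hdom.mono' ?_ (Eventually.of_forall fun ω => ?_)
  · exact (((((hZ i).pow_const a).mul ((hZ j).pow_const b)).mul
      ((hJG.continuous m).measurable.comp_aemeasurable (hZ k))).mul
      ((hJH.continuous n).measurable.comp_aemeasurable (hZ l))).aestronglyMeasurable
  · have hK : 0 ≤ K := (abs_nonneg _).trans (hJG.2 m hmm 0)
    rw [Real.norm_eq_abs]
    refine (mul_bound_le (hJG.2 m hmm _) (hJH.2 n hn _)).trans ?_
    gcongr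
    exact abs_pow_mul_pow_le _ _ _ _

lemma abs_mixedMoment_le (hG : HasGaussianLaw (fun ω k => Z k ω) P)
    (hm : ∀ k, ∫ ω, Z k ω ∂P = 0)
    (hJG : IsBoundedJet K G) (hJH : IsBoundedJet K H) {i j : ι}
    (hi : ∫ ω, Z i ω * Z i ω ∂P = 1) (hj : ∫ ω, Z j ω * Z j ω ∂P = 1) (k l : ι) (a b : ℕ) {m n : ℕ}
    (hmm : m ≤ 2) (hn : n ≤ 2) :
    |mixedMoment P Z G H i j k l a b m n| ≤ (stdMoment a + stdMoment b) * K * K := by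
  have hK : 0 ≤ K := (abs_nonneg _).trans (hJG.2 m hmm 0)
  have ii := integrable_pow_of_hasGaussianLaw (hG.eval i) (2 * a)
  have ij := integrable_pow_of_hasGaussianLaw (hG.eval j) (2 * b)
  rw [← integral_pow_eq_stdMoment (hG.eval i) (hm i) hi,
    ← integral_pow_eq_stdMoment (hG.eval j) (hm j) hj, ← integral_add ii ij, ← integral_mul_const,
    ← integral_mul_const, ← Real.norm_eq_abs]
  refine norm_integral_le_of_norm_le (((ii.add ij).mul_const K).mul_const K)
    (Eventually.of_forall fun ω => ?_)
  rw [Real.norm_eq_abs]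
  refine (mul_bound_le (hJG.2 m hmm _) (hJH.2 n hn _)).trans ?_
  gcongr
  exact abs_pow_mul_pow_le _ _ _ _

lemma integral_add_four {f₁ f₂ f₃ f₄ : Ω → ℝ} (h₁ : Integrable f₁ P) (h₂ : Integrable f₂ P)
    (h₃ : Integrable f₃ P) (h₄ : Integrable f₄ P) :
    ∫ ω, (f₁ ω + f₂ ω + f₃ ω + f₄ ω) ∂P =
      ∫ ω, f₁ ω ∂P + ∫ ω, f₂ ω ∂P + ∫ ω, f₃ ω ∂P + ∫ ω, f₄ ω ∂P := by
  have e₁ : ∫ ω, (f₁ ω + f₂ ω) ∂P = _ := integral_add h₁ h₂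
  have e₂ : ∫ ω, (f₁ ω + f₂ ω + f₃ ω) ∂P = _ := integral_add (h₁.add h₂) h₃
  have e₃ : ∫ ω, (f₁ ω + f₂ ω + f₃ ω + f₄ ω) ∂P = _ := integral_add ((h₁.add h₂).add h₃) h₄
  rw [e₃, ← e₁, ← e₂]

lemma mixedMoment_succ [Fintype ι] (hG : HasGaussianLaw (fun ω k => Z k ω) P)
    (hm : ∀ k, ∫ ω, Z k ω ∂P = 0)
    (hJG : IsBoundedJet K G) (hJH : IsBoundedJet K H) {i : ι}
    (hi : ∫ ω, Z i ω * Z i ω ∂P = 1) (j k l : ι) (a b : ℕ) {m n : ℕ}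
    (hmm : m ≤ 1) (hn : n ≤ 1) :
    mixedMoment P Z G H i j k l (a + 1) b m n =
      a * mixedMoment P Z G H i j k l (a - 1) b m n +
      b * (∫ ω, Z i ω * Z j ω ∂P) * mixedMoment P Z G H i j k l a (b - 1) m n +
      (∫ ω, Z i ω * Z k ω ∂P) * mixedMoment P Z G H i j k l a b (m + 1) n +
      (∫ ω, Z i ω * Z l ω ∂P) * mixedMoment P Z G H i j k l a b m (n + 1) := by
  have I := fun (a b : ℕ) {m n : ℕ} (h1 : m ≤ 2) (h2 : n ≤ 2) =>
    integrable_mixed hG hJG hJH i j k l a b h1 h2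
  set r := ∫ ω, Z i ω * Z j ω ∂P
  set s := ∫ ω, Z i ω * Z k ω ∂P
  set t := ∫ ω, Z i ω * Z l ω ∂P
  have cG := hJG.continuous
  have cH := hJH.continuous
  have I1 := (I (a - 1) b (m := m) (n := n) (by omega) (by omega)).const_mul (a : ℝ)
  have I2 := (I a (b - 1) (m := m) (n := n) (by omega) (by omega)).const_mul ((b : ℝ) * r)
  have I3 := (I a b (m := m + 1) (n := n) (by omega) (by omega)).const_mul s
  have I4 := (I a b (m := m) (n := n + 1) (by omega) (by omega)).const_mul t
  have key := gaussian_integration_by_parts hG hm hi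
    (φ := fun z => z i ^ a * z j ^ b * G m (z k) * H n (z l))
    (φ' := fun z => a * (z i ^ (a - 1) * z j ^ b * G m (z k) * H n (z l)) +
      b * r * (z i ^ a * z j ^ (b - 1) * G m (z k) * H n (z l)) +
      s * (z i ^ a * z j ^ b * G (m + 1) (z k) * H n (z l)) +
      t * (z i ^ a * z j ^ b * G m (z k) * H (n + 1) (z l)))
    (by fun_prop) (by fun_prop) (by
      intro w u
      have hc : ∀ k', HasDerivAt (fun u : ℝ => w k' + u * ∫ ω, Z i ω * Z k' ω ∂P)
          (∫ ω, Z i ω * Z k' ω ∂P) u := fun k' => by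
        simpa using ((hasDerivAt_id u).mul_const (∫ ω, Z i ω * Z k' ω ∂P)).const_add (w k')
      have h := ((((hc i).pow a).mul ((hc j).pow b)).mul ((hJG.1 m _).comp u (hc k))).mul
        ((hJH.1 n _).comp u (hc l))
      simp only [Pi.add_apply, Pi.smul_apply, smul_eq_mul]
      convert! h using 1
      simp only [Pi.mul_apply, Pi.pow_apply, Function.comp, hi]
      ring)
    (I a b (by omega) (by omega))
    ((I (a + 1) b (m := m) (n := n) (by omega) (by omega)).congr
      (Eventually.of_forall fun ω => by ring))
    (((I1.add I2).add I3).add I4)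
  simp only [mixedMoment]
  refine Eq.trans (integral_congr_ae (Eventually.of_forall fun ω => ?_))
    (key.trans ((integral_add_four I1 I2 I3 I4).trans ?_))
  · simp only
    ring
  · simp only [integral_const_mul]

/-- An odd power of a standard coordinate makes the mixed moment small when this coordinate is
nearly uncorrelated with the others. -/
lemma exists_abs_mixedMoment_le_of_odd_left [Fintype ι] (K : ℝ) (a b : ℕ) (ha : Odd a) :
    ∃ C : ℝ, 0 ≤ C ∧ ∀ (P : Measure Ω) (Z : ι → Ω → ℝ) (G H : ℕ → ℝ → ℝ) (i j k l : ι) (m n : ℕ),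
      HasGaussianLaw (fun ω k => Z k ω) P → (∀ k, ∫ ω, Z k ω ∂P = 0) →
      IsBoundedJet K G → IsBoundedJet K H → ∫ ω, Z i ω * Z i ω ∂P = 1 →
      ∫ ω, Z j ω * Z j ω ∂P = 1 → m ≤ 1 → n ≤ 1 →
      |mixedMoment P Z G H i j k l a b m n| ≤
        C * (|∫ ω, Z i ω * Z j ω ∂P| + |∫ ω, Z i ω * Z k ω ∂P| + |∫ ω, Z i ω * Z l ω ∂P|) := by
  obtain ⟨d, rfl⟩ := ha
  induction d with
  | zero =>
    set M1 := (stdMoment 0 + stdMoment (b - 1)) * K * K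
    set M2 := (stdMoment 0 + stdMoment b) * K * K
    have hM1n : 0 ≤ M1 := stdMoment_add_mul_nonneg K _ _
    have hM2n : 0 ≤ M2 := stdMoment_add_mul_nonneg K _ _
    refine ⟨b * M1 + M2, by positivity, ?_⟩
    intro P Z G H i j k l m n hG hm hJG hJH hi hj hm1 hn1
    have e := mixedMoment_succ hG hm hJG hJH hi j k l 0 b hm1 hn1
    have b1 := abs_mixedMoment_le hG hm hJG hJH hi hj k l 0 (b - 1) (m := m) (n := n)
      (by omega) (by omega)
    have b2 := abs_mixedMoment_le hG hm hJG hJH hi hj k l 0 b (m := m + 1) (n := n)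
      (by omega) (by omega)
    have b3 := abs_mixedMoment_le hG hm hJG hJH hi hj k l 0 b (m := m) (n := n + 1)
      (by omega) (by omega)
    simp only [mul_zero, zero_add, Nat.cast_zero, zero_mul] at e ⊢
    rw [e]
    set r := ∫ ω, Z i ω * Z j ω ∂P
    set s := ∫ ω, Z i ω * Z k ω ∂P
    set t := ∫ ω, Z i ω * Z l ω ∂P
    calc _ ≤ (b * |r|) * M1 + |s| * M2 + |t| * M2 := by
          refine (abs_add_three _ _ _).trans ?_
          simp only [abs_mul, Nat.abs_cast]
          gcongr
      _ ≤ _ := by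
          nlinarith [mul_nonneg hM2n (abs_nonneg r), mul_nonneg (mul_nonneg b.cast_nonneg hM1n)
            (abs_nonneg s), mul_nonneg (mul_nonneg b.cast_nonneg hM1n) (abs_nonneg t)]
  | succ d ih =>
    obtain ⟨C0, hC0, ih⟩ := ih
    set M1 := (stdMoment (2 * d + 2) + stdMoment (b - 1)) * K * K
    set M2 := (stdMoment (2 * d + 2) + stdMoment b) * K * K
    have hM1n : 0 ≤ M1 := stdMoment_add_mul_nonneg K _ _
    have hM2n : 0 ≤ M2 := stdMoment_add_mul_nonneg K _ _
    refine ⟨(2 * d + 2) * C0 + (b * M1 + M2), by positivity, ?_⟩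
    intro P Z G H i j k l m n hG hm hJG hJH hi hj hm1 hn1
    have e := mixedMoment_succ hG hm hJG hJH hi j k l (2 * d + 2) b hm1 hn1
    have b0 := ih P Z G H i j k l m n hG hm hJG hJH hi hj hm1 hn1
    have b1 := abs_mixedMoment_le hG hm hJG hJH hi hj k l (2 * d + 2) (b - 1) (m := m) (n := n)
      (by omega) (by omega)
    have b2 := abs_mixedMoment_le hG hm hJG hJH hi hj k l (2 * d + 2) b (m := m + 1) (n := n)
      (by omega) (by omega)
    have b3 := abs_mixedMoment_le hG hm hJG hJH hi hj k l (2 * d + 2) b (m := m) (n := n + 1)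
      (by omega) (by omega)
    rw [show 2 * d + 2 - 1 = 2 * d + 1 by omega] at e
    rw [show 2 * (d + 1) + 1 = 2 * d + 2 + 1 by omega, e]
    set r := ∫ ω, Z i ω * Z j ω ∂P
    set s := ∫ ω, Z i ω * Z k ω ∂P
    set t := ∫ ω, Z i ω * Z l ω ∂P
    calc _ ≤ ((2 * d + 2 : ℕ) : ℝ) * (C0 * (|r| + |s| + |t|)) +
            (b * |r|) * M1 + |s| * M2 + |t| * M2 := by
          refine (abs_add_le _ _).trans (add_le_add ((abs_add_three _ _ _).trans ?_) ?_)
          all_goals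
            simp only [abs_mul, Nat.abs_cast]
            gcongr
      _ ≤ _ := by
          push_cast
          nlinarith [mul_nonneg hM2n (abs_nonneg r), mul_nonneg (mul_nonneg b.cast_nonneg hM1n)
            (abs_nonneg s), mul_nonneg (mul_nonneg b.cast_nonneg hM1n) (abs_nonneg t)]

/-- Two odd powers of standard coordinates yield a bound that is quadratic in the covariances of
these coordinates with the arguments of the weights. -/
lemma exists_abs_mixedMoment_le_of_odd [Fintype ι] (K : ℝ) (a b : ℕ) (ha : Odd a) (hb : Odd b) :
    ∃ C : ℝ, 0 ≤ C ∧ ∀ (P : Measure Ω) (Z : ι → Ω → ℝ) (G H : ℕ → ℝ → ℝ) (i j k l : ι),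
      HasGaussianLaw (fun ω k => Z k ω) P → (∀ k, ∫ ω, Z k ω ∂P = 0) →
      IsBoundedJet K G → IsBoundedJet K H → ∫ ω, Z i ω * Z i ω ∂P = 1 →
      ∫ ω, Z j ω * Z j ω ∂P = 1 → |∫ ω, Z i ω * Z k ω ∂P| ≤ 1 → |∫ ω, Z i ω * Z l ω ∂P| ≤ 1 →
      |mixedMoment P Z G H i j k l a b 0 0| ≤
        C * (|∫ ω, Z i ω * Z j ω ∂P| +
          (|∫ ω, Z i ω * Z k ω ∂P| + |∫ ω, Z i ω * Z l ω ∂P|) *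
          (|∫ ω, Z j ω * Z k ω ∂P| + |∫ ω, Z j ω * Z l ω ∂P|)) := by
  obtain ⟨d, rfl⟩ := ha
  induction d with
  | zero =>
    obtain ⟨C1, hC1, odd1⟩ :=
      exists_abs_mixedMoment_le_of_odd_left (Ω := Ω) (ι := ι) K b 0 hb
    set M1 := (stdMoment 0 + stdMoment (b - 1)) * K * K
    have hM1n : 0 ≤ M1 := stdMoment_add_mul_nonneg K _ _
    refine ⟨b * M1 + 2 * C1, by positivity, ?_⟩
    intro P Z G H i j k l hG hm hJG hJH hi hj hs ht
    have e := mixedMoment_succ hG hm hJG hJH hi j k l 0 b (m := 0) (n := 0) (by omega) (by omega)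
    have b1 := abs_mixedMoment_le hG hm hJG hJH hi hj k l 0 (b - 1) (m := 0) (n := 0)
      (by omega) (by omega)
    have b2 := odd1 P Z G H j i k l 1 0 hG hm hJG hJH hj hi le_rfl zero_le_one
    have b3 := odd1 P Z G H j i k l 0 1 hG hm hJG hJH hj hi zero_le_one le_rfl
    rw [mixedMoment_swap] at b2 b3
    have hr : ∫ ω, Z j ω * Z i ω ∂P = ∫ ω, Z i ω * Z j ω ∂P := by simp only [mul_comm]
    rw [hr] at b2 b3
    simp only [mul_zero, zero_add, Nat.cast_zero, zero_mul] at e ⊢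
    rw [e]
    set r := ∫ ω, Z i ω * Z j ω ∂P
    set s := ∫ ω, Z i ω * Z k ω ∂P
    set t := ∫ ω, Z i ω * Z l ω ∂P
    set s' := ∫ ω, Z j ω * Z k ω ∂P
    set t' := ∫ ω, Z j ω * Z l ω ∂P
    calc _ ≤ (b * |r|) * M1 + |s| * (C1 * (|r| + |s'| + |t'|)) +
            |t| * (C1 * (|r| + |s'| + |t'|)) := by
          refine (abs_add_three _ _ _).trans ?_
          simp only [abs_mul, Nat.abs_cast]
          gcongr
      _ = b * M1 * |r| + C1 * ((|s| + |t|) * |r| + (|s| + |t|) * (|s'| + |t'|)) := by ring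
      _ ≤ b * M1 * (|r| + (|s| + |t|) * (|s'| + |t'|)) +
            C1 * (2 * |r| + 2 * ((|s| + |t|) * (|s'| + |t'|))) := by
          have h0 : 0 ≤ (|s| + |t|) * (|s'| + |t'|) := by positivity
          have h1 : (|s| + |t|) * |r| ≤ 2 * |r| := by gcongr; linarith
          have h2 : |r| ≤ |r| + (|s| + |t|) * (|s'| + |t'|) := by linarith
          have h3 : (|s| + |t|) * |r| + (|s| + |t|) * (|s'| + |t'|) ≤
              2 * |r| + 2 * ((|s| + |t|) * (|s'| + |t'|)) := by linarith
          gcongr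
      _ = _ := by ring
  | succ d ih =>
    obtain ⟨C0, hC0, ih⟩ := ih
    obtain ⟨C1, hC1, odd1⟩ :=
      exists_abs_mixedMoment_le_of_odd_left (Ω := Ω) (ι := ι) K b (2 * d + 2) hb
    set M1 := (stdMoment (2 * d + 2) + stdMoment (b - 1)) * K * K
    have hM1n : 0 ≤ M1 := stdMoment_add_mul_nonneg K _ _
    refine ⟨(2 * d + 2) * C0 + (b * M1 + 2 * C1), by positivity, ?_⟩
    intro P Z G H i j k l hG hm hJG hJH hi hj hs ht
    have e := mixedMoment_succ hG hm hJG hJH hi j k l (2 * d + 2) b (m := 0) (n := 0)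
      (by omega) (by omega)
    have b0 := ih P Z G H i j k l hG hm hJG hJH hi hj hs ht
    have b1 := abs_mixedMoment_le hG hm hJG hJH hi hj k l (2 * d + 2) (b - 1) (m := 0) (n := 0)
      (by omega) (by omega)
    have b2 := odd1 P Z G H j i k l 1 0 hG hm hJG hJH hj hi le_rfl zero_le_one
    have b3 := odd1 P Z G H j i k l 0 1 hG hm hJG hJH hj hi zero_le_one le_rfl
    rw [mixedMoment_swap] at b2 b3
    have hr : ∫ ω, Z j ω * Z i ω ∂P = ∫ ω, Z i ω * Z j ω ∂P := by simp only [mul_comm]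
    rw [hr] at b2 b3
    rw [show 2 * d + 2 - 1 = 2 * d + 1 by omega] at e
    rw [show 2 * (d + 1) + 1 = 2 * d + 2 + 1 by omega, e]
    simp only [zero_add]
    set r := ∫ ω, Z i ω * Z j ω ∂P
    set s := ∫ ω, Z i ω * Z k ω ∂P
    set t := ∫ ω, Z i ω * Z l ω ∂P
    set s' := ∫ ω, Z j ω * Z k ω ∂P
    set t' := ∫ ω, Z j ω * Z l ω ∂P
    calc _ ≤ ((2 * d + 2 : ℕ) : ℝ) * (C0 * (|r| + (|s| + |t|) * (|s'| + |t'|))) +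
            (b * |r|) * M1 + |s| * (C1 * (|r| + |s'| + |t'|)) +
            |t| * (C1 * (|r| + |s'| + |t'|)) := by
          refine (abs_add_le _ _).trans (add_le_add ((abs_add_three _ _ _).trans ?_) ?_)
          all_goals
            simp only [abs_mul, Nat.abs_cast]
            gcongr
      _ = (2 * d + 2) * C0 * (|r| + (|s| + |t|) * (|s'| + |t'|)) +
            (b * M1 * |r| + C1 * ((|s| + |t|) * |r| + (|s| + |t|) * (|s'| + |t'|))) := by
          push_cast
          ring
      _ ≤ (2 * d + 2) * C0 * (|r| + (|s| + |t|) * (|s'| + |t'|)) +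
            (b * M1 * (|r| + (|s| + |t|) * (|s'| + |t'|)) +
            C1 * (2 * |r| + 2 * ((|s| + |t|) * (|s'| + |t'|)))) := by
          have h0 : 0 ≤ (|s| + |t|) * (|s'| + |t'|) := by positivity
          have h1 : (|s| + |t|) * |r| ≤ 2 * |r| := by gcongr; linarith
          have h2 : |r| ≤ |r| + (|s| + |t|) * (|s'| + |t'|) := by linarith
          have h3 : (|s| + |t|) * |r| + (|s| + |t|) * (|s'| + |t'|) ≤
              2 * |r| + 2 * ((|s| + |t|) * (|s'| + |t'|)) := by linarith
          gcongr
      _ = _ := by ring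

end MixedMoments

/-- The increment of `|x|^h` over `[x, x + 1]`. -/
def absRpowIncr (h x : ℝ) : ℝ := |x + 1| ^ h - |x| ^ h

lemma abs_absRpowIncr_le_one {h : ℝ} (h0 : 0 < h) (h1 : h < 1) (x : ℝ) :
    |absRpowIncr h x| ≤ 1 := by
  have key : ∀ a b : ℝ, |a - b| ≤ 1 → |a| ^ h - |b| ^ h ≤ 1 := by
    intro a b hab
    have h2 : |a| ≤ |b| + 1 := by linarith [abs_sub_abs_le_abs_sub a b]
    have h3 : |a| ^ h ≤ (|b| + 1) ^ h := by gcongr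
    have h4 := Real.rpow_add_le_add_rpow (abs_nonneg b) zero_le_one h0.le h1.le
    rw [Real.one_rpow] at h4
    linarith
  rw [absRpowIncr, abs_le]
  constructor
  · linarith [key x (x + 1) (by simp)]
  · exact key (x + 1) x (by simp)

lemma rpow_add_one_add_rpow_sub_one_le {h : ℝ} (h0 : 0 < h) (h1 : h < 1) {y : ℝ} (hy : 1 ≤ y) :
    (y + 1) ^ h + (y - 1) ^ h ≤ 2 * y ^ h := by
  have := (Real.concaveOn_rpow h0.le h1.le).2 (show y + 1 ∈ Set.Ici 0 from Set.mem_Ici.2 (by linarith))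
    (show y - 1 ∈ Set.Ici 0 from Set.mem_Ici.2 (by linarith))
    (show (0 : ℝ) ≤ 1 / 2 by norm_num) (show (0 : ℝ) ≤ 1 / 2 by norm_num) (by norm_num)
  simp only [smul_eq_mul] at this
  rw [show 1 / 2 * (y + 1) + 1 / 2 * (y - 1) = y by ring] at this
  linarith

lemma abs_rhoH_le {H : ℝ} (hH0 : 0 < H) (hH : H < 1 / 2) (k : ℤ) :
    |rhoH H k| ≤ (absRpowIncr (2 * H) ((k : ℝ) - 1) - absRpowIncr (2 * H) k) / 2 +
      if k = 0 then 2 else 0 := by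
  have h0 : 0 < 2 * H := by linarith
  split_ifs with hk
  · subst hk
    simp [rhoH, absRpowIncr, Real.zero_rpow h0.ne']
    norm_num
  · have hneg : |(k : ℝ) + 1| ^ (2 * H) + |(k : ℝ) - 1| ^ (2 * H) ≤ 2 * |(k : ℝ)| ^ (2 * H) := by
      have h1 : 1 ≤ |(k : ℝ)| := by exact_mod_cast Int.one_le_abs hk
      have h2 := rpow_add_one_add_rpow_sub_one_le h0 (by linarith) h1
      rcases le_total 0 (k : ℝ) with hk0 | hk0
      · rw [abs_of_nonneg hk0] at h1 h2 ⊢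
        rwa [abs_of_nonneg (by linarith), abs_of_nonneg (by linarith)]
      · rw [abs_of_nonpos hk0] at h1 h2 ⊢
        rw [abs_of_nonpos (by linarith), abs_of_nonpos (by linarith),
          show -((k : ℝ) + 1) = -k - 1 by ring, show -((k : ℝ) - 1) = -k + 1 by ring]
        linarith
    rw [rhoH, abs_of_nonpos (by linarith), absRpowIncr, absRpowIncr, sub_add_cancel]
    linarith

lemma sum_abs_rhoH_le {H : ℝ} (hH0 : 0 < H) (hH : H < 1 / 2) (N l : ℕ) :
    ∑ j ∈ Finset.range N, |rhoH H ((j : ℤ) - l)| ≤ 3 := by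
  have hb := abs_absRpowIncr_le_one (h := 2 * H) (by linarith) (by linarith)
  calc _ ≤ ∑ j ∈ Finset.range N, ((absRpowIncr (2 * H) ((j : ℝ) - l - 1) -
          absRpowIncr (2 * H) (((j + 1 : ℕ) : ℝ) - l - 1)) / 2 + if j = l then 2 else 0) := by
        refine Finset.sum_le_sum fun j _ => (abs_rhoH_le hH0 hH _).trans (le_of_eq ?_)
        congr 1
        · push_cast
          ring_nf
        · simp [sub_eq_zero]
    _ = (absRpowIncr (2 * H) (((0 : ℕ) : ℝ) - l - 1) -
          absRpowIncr (2 * H) ((N : ℝ) - l - 1)) / 2 +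
          ∑ j ∈ Finset.range N, if j = l then (2 : ℝ) else 0 := by
        rw [Finset.sum_add_distrib, ← Finset.sum_div,
          Finset.sum_range_sub' fun j : ℕ => absRpowIncr (2 * H) ((j : ℝ) - l - 1)]
    _ ≤ (1 + 1) / 2 + 2 := by
        have e1 := (abs_le.1 (hb (((0 : ℕ) : ℝ) - l - 1))).2
        have e2 := (abs_le.1 (hb ((N : ℝ) - l - 1))).1
        gcongr
        · linarith
        · rw [Finset.sum_ite_eq']
          split_ifs <;> norm_num
    _ = 3 := by norm_num

lemma sum_abs_absRpowIncr_le {h : ℝ} (h0 : 0 < h) {N m : ℕ} (hm : m ≤ N) :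
    ∑ j ∈ Finset.range N, |absRpowIncr h ((j : ℝ) - m)| ≤ 2 * (N : ℝ) ^ h := by
  set s : ℤ → ℝ := fun x => if 0 ≤ x then (x : ℝ) ^ h else -(-(x : ℝ)) ^ h with hs
  have key : ∀ x : ℤ, |absRpowIncr h x| = s (x + 1) - s x := by
    intro x
    rcases lt_trichotomy x (-1) with hx | hx | hx
    · have hx' : (x : ℝ) < -1 := by exact_mod_cast hx
      simp only [hs, absRpowIncr]
      rw [if_neg (by omega), if_neg (by omega), abs_of_neg (a := (x : ℝ) + 1) (by linarith),
        abs_of_neg (a := (x : ℝ)) (by linarith), abs_of_nonpos]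
      · push_cast
        ring
      · rw [sub_nonpos]
        exact Real.rpow_le_rpow (by linarith) (by linarith) h0.le
    · subst hx
      simp [hs, absRpowIncr, Real.zero_rpow h0.ne']
    · have hx0 : 0 ≤ x := by omega
      have hx' : (0 : ℝ) ≤ x := by exact_mod_cast hx0
      simp only [hs, absRpowIncr]
      rw [if_pos (by omega), if_pos (by omega), abs_of_nonneg (a := (x : ℝ) + 1) (by linarith),
        abs_of_nonneg (a := (x : ℝ)) hx', abs_of_nonneg]
      · push_cast
        ring
      · rw [sub_nonneg]
        exact Real.rpow_le_rpow (by linarith) (by linarith) h0.le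
  calc _ = ∑ j ∈ Finset.range N, (s (((j + 1 : ℕ) : ℤ) - m) - s ((j : ℤ) - m)) := by
        refine Finset.sum_congr rfl fun j _ => ?_
        have := key ((j : ℤ) - m)
        push_cast at this ⊢
        rw [this]
        congr 2
        ring
    _ = s ((N : ℤ) - m) - s (((0 : ℕ) : ℤ) - m) :=
        Finset.sum_range_sub (fun j : ℕ => s ((j : ℤ) - m)) N
    _ ≤ (N : ℝ) ^ h + (N : ℝ) ^ h := by
        rw [sub_eq_add_neg]
        have hmN : (m : ℝ) ≤ N := by exact_mod_cast hm
        refine add_le_add ?_ ?_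
        · simp only [hs]
          rw [if_pos (by omega)]
          push_cast
          exact Real.rpow_le_rpow (by linarith) (by linarith [(Nat.cast_nonneg m : (0 : ℝ) ≤ m)])
            h0.le
        · simp only [hs]
          rcases Nat.eq_zero_or_pos m with rfl | hm0
          · simp [Real.zero_rpow h0.ne']
            positivity
          · rw [if_neg (by omega)]
            push_cast
            rw [zero_sub, neg_neg, neg_neg]
            exact Real.rpow_le_rpow (by positivity) hmN h0.le
    _ = _ := by ring

/-- Covariance between the increment over `[j, j + 1]` and the average of the values at
`l` and `l + 1`. -/
def incrMidCov (H : ℝ) (j l : ℕ) : ℝ :=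
  (covH H (j + 1) (l + 1) + covH H (j + 1) l - covH H j (l + 1) - covH H j l) / 2

lemma incrMidCov_eq (H : ℝ) (j l : ℕ) :
    incrMidCov H j l = (2 * absRpowIncr (2 * H) j -
      absRpowIncr (2 * H) ((j : ℝ) - (l + 1)) - absRpowIncr (2 * H) ((j : ℝ) - l)) / 4 := by
  simp only [incrMidCov, covH, absRpowIncr]
  rw [show (j : ℝ) - (l + 1) + 1 = j + 1 - (l + 1) by ring,
    show (j : ℝ) - l + 1 = j + 1 - l by ring]
  ring

lemma abs_incrMidCov_le (H : ℝ) (j l : ℕ) :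
    |incrMidCov H j l| ≤ (2 * |absRpowIncr (2 * H) j| +
      |absRpowIncr (2 * H) ((j : ℝ) - (l + 1))| + |absRpowIncr (2 * H) ((j : ℝ) - l)|) / 4 := by
  rw [incrMidCov_eq, abs_div, abs_of_pos (by norm_num : (0 : ℝ) < 4)]
  gcongr
  refine (abs_sub _ _).trans ?_
  gcongr
  refine (abs_sub _ _).trans ?_
  rw [abs_mul, abs_two]

lemma abs_incrMidCov_le_one {H : ℝ} (hH0 : 0 < H) (hH : H < 1 / 2) (j l : ℕ) :
    |incrMidCov H j l| ≤ 1 := by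
  have hb := abs_absRpowIncr_le_one (h := 2 * H) (by linarith) (by linarith)
  have := abs_incrMidCov_le H j l
  linarith [hb (j : ℝ), hb ((j : ℝ) - (l + 1)), hb ((j : ℝ) - l)]

lemma sum_abs_incrMidCov_le {H : ℝ} (hH0 : 0 < H) {N l : ℕ} (hl : l < N) :
    ∑ j ∈ Finset.range N, |incrMidCov H j l| ≤ 2 * (N : ℝ) ^ (2 * H) := by
  have hb := fun {m : ℕ} (hm : m ≤ N) =>
    sum_abs_absRpowIncr_le (h := 2 * H) (by linarith) (N := N) (m := m) hm
  refine (Finset.sum_le_sum fun j _ => abs_incrMidCov_le H j l).trans ?_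
  rw [← Finset.sum_div, Finset.sum_add_distrib, Finset.sum_add_distrib, ← Finset.mul_sum]
  have e0 := hb (Nat.zero_le N)
  have e1 := hb (Nat.succ_le_of_lt hl)
  have e2 := hb hl.le
  push_cast at e0 e1
  simp only [sub_zero] at e0
  linarith

/-- At the midpoint of its own interval an increment decorrelates, up to a telescoping term. -/
lemma incrMidCov_self (H : ℝ) (j : ℕ) :
    incrMidCov H j j = absRpowIncr (2 * H) j / 2 := by
  simp only [incrMidCov, covH, absRpowIncr]
  rw [show |(j : ℝ) + 1 - j| = |(j : ℝ) - (j + 1)| by rw [abs_sub_comm]]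
  simp only [sub_self]
  ring

lemma sum_abs_incrMidCov_self_le {H : ℝ} (hH0 : 0 < H) (N : ℕ) :
    ∑ j ∈ Finset.range N, |incrMidCov H j j| ≤ (N : ℝ) ^ (2 * H) := by
  have hb := sum_abs_absRpowIncr_le (h := 2 * H) (by linarith) (Nat.zero_le N)
  simp only [Nat.cast_zero, sub_zero] at hb
  simp only [incrMidCov_self, abs_div, abs_two]
  rw [← Finset.sum_div]
  linarith

lemma sum_sum_covariances_le {H : ℝ} (hH0 : 0 < H) (hH : H < 1 / 2) (N : ℕ) {ε : ℝ} (hε : 0 ≤ ε) :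
    ∑ j ∈ Finset.range N, ∑ l ∈ Finset.range N, (|rhoH H ((j : ℤ) - l)| +
      ε * ((|incrMidCov H j j| + |incrMidCov H j l|) *
        (|incrMidCov H l j| + |incrMidCov H l l|))) ≤
      N * (3 + 6 * (ε * (N : ℝ) ^ (2 * H))) := by
  rw [Finset.sum_comm]
  have h1 := abs_incrMidCov_le_one hH0 hH
  calc _ ≤ ∑ l ∈ Finset.range N, ((3 : ℝ) + 6 * (ε * (N : ℝ) ^ (2 * H))) := by
        refine Finset.sum_le_sum fun l hl => ?_
        rw [Finset.sum_add_distrib, ← Finset.mul_sum]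
        have e1 := sum_abs_rhoH_le hH0 hH N l
        have e2 : ∑ j ∈ Finset.range N, (|incrMidCov H j j| + |incrMidCov H j l|) *
            (|incrMidCov H l j| + |incrMidCov H l l|) ≤ 6 * (N : ℝ) ^ (2 * H) := by
          calc _ ≤ ∑ j ∈ Finset.range N, (|incrMidCov H j j| + |incrMidCov H j l|) * 2 := by
                gcongr with j
                linarith [h1 l j, h1 l l]
            _ ≤ _ := by
                rw [← Finset.sum_mul, Finset.sum_add_distrib]
                linarith [sum_abs_incrMidCov_self_le hH0 N,
                  sum_abs_incrMidCov_le hH0 (Finset.mem_range.1 hl)]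
        have e3 := mul_le_mul_of_nonneg_left e2 hε
        linarith
    _ = _ := by rw [Finset.sum_const, Finset.card_range, nsmul_eq_mul]

lemma contDiff_section {f : ℝ → ℝ → ℝ} (hf : CbSmooth2 f) (x : ℝ) (n : ℕ) :
    ContDiff ℝ n (f x) := by
  have h := hf.1 n
  exact h.comp (f := fun y : ℝ => (x, y)) (by fun_prop)

lemma abs_iteratedDeriv_section_le {f : ℝ → ℝ → ℝ} (hf : CbSmooth2 f) (k : ℕ) (x y : ℝ) :
    |iteratedDeriv k (f x) y| ≤ ‖iteratedFDeriv ℝ k (fun p : ℝ × ℝ => f p.1 p.2) (x, y)‖ := by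
  set F : ℝ × ℝ → ℝ := fun p => f p.1 p.2
  have hF : ContDiff ℝ k fun p : ℝ × ℝ => F (p + (x, 0)) := (hf.1 k).comp (by fun_prop)
  have e : f x = (fun p : ℝ × ℝ => F (p + (x, 0))) ∘ ContinuousLinearMap.inr ℝ ℝ ℝ := by
    ext y
    simp [F]
  rw [← Real.norm_eq_abs, ← norm_iteratedFDeriv_eq_norm_iteratedDeriv, e,
    ContinuousLinearMap.iteratedFDeriv_comp_right _ hF y le_rfl, iteratedFDeriv_comp_add_right]
  refine (ContinuousMultilinearMap.norm_compContinuousLinearMap_le _ _).trans ?_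
  have e2 : ContinuousLinearMap.inr ℝ ℝ ℝ y + (x, 0) = (x, y) := by simp
  rw [e2]
  refine mul_le_of_le_one_right (norm_nonneg _) (Finset.prod_le_one (fun _ _ => norm_nonneg _) ?_)
  exact fun _ _ => ContinuousLinearMap.norm_inr_le_one ℝ ℝ ℝ

lemma exists_isBoundedJet {f : ℝ → ℝ → ℝ} (hf : CbSmooth2 f) :
    ∃ K, ∀ x, IsBoundedJet K fun m => iteratedDeriv m (f x) := by
  choose M hM using hf.2
  refine ⟨max (M 0) (max (M 1) (M 2)), fun x => ⟨fun m y => ?_, fun m hm y => ?_⟩⟩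
  · simp only [iteratedDeriv_succ (n := m)]
    exact ((contDiff_section hf x (m + 1)).differentiable_iteratedDeriv m
      (by exact_mod_cast Nat.lt_succ_self m) y).hasDerivAt
  · refine (abs_iteratedDeriv_section_le hf m x y).trans ((hM m _).trans ?_)
    interval_cases m <;> simp

section GaussianProcess

variable [MeasurableSpace Ω] {P : Measure Ω} {X : ℝ → Ω → ℝ}

lemma IsCenteredGaussianProcess.hasGaussianLaw {C : ℝ → ℝ → ℝ}
    (hX : IsCenteredGaussianProcess P X C) {m : ℕ} (ts : Fin m → ℝ) :
    HasGaussianLaw (fun ω i => X (ts i) ω) P := by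
  have hmeas : Measurable fun ω i => X (ts i) ω := measurable_pi_lambda _ fun i => hX.1 _
  refine ⟨isGaussian_of_map_eq_gaussianReal fun L => ⟨0,
    (∑ i, ∑ j, L (Pi.single i 1) * L (Pi.single j 1) * C (ts i) (ts j)).toNNReal, ?_⟩⟩
  rw [Measure.map_map (by fun_prop) hmeas, ← hX.2 m ts fun i => L (Pi.single i 1)]
  congr 1
  ext ω
  rw [Function.comp_apply, ← L.sum_comp_single]
  refine Finset.sum_congr rfl fun i _ => ?_
  have : (Pi.single i (X (ts i) ω) : Fin m → ℝ) = X (ts i) ω • Pi.single i 1 := by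
    rw [← Pi.single_smul]
    simp
  simp [this, mul_comm]

lemma IsCenteredGaussianProcess.integral_eq_zero {C : ℝ → ℝ → ℝ}
    (hX : IsCenteredGaussianProcess P X C) (s : ℝ) : ∫ ω, X s ω ∂P = 0 := by
  have h := hX.2 1 (fun _ => s) fun _ => 1
  simp only [Finset.univ_unique, Finset.sum_singleton, one_mul] at h
  have e := integral_map (μ := P) (hX.1 s).aemeasurable (f := fun x : ℝ => x) (by fun_prop)
  rw [← e, h, integral_id_gaussianReal]

lemma IsCenteredGaussianProcess.memLp {C : ℝ → ℝ → ℝ}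
    (hX : IsCenteredGaussianProcess P X C) (s : ℝ) : MemLp (X s) 2 P :=
  ((hX.hasGaussianLaw fun _ : Fin 1 => s).eval 0).memLp_two

lemma IsCenteredGaussianProcess.integral_sq_linear {C : ℝ → ℝ → ℝ}
    (hX : IsCenteredGaussianProcess P X C) {m : ℕ} (ts c : Fin m → ℝ) :
    ∫ ω, (∑ i, c i * X (ts i) ω) ^ 2 ∂P =
      ((∑ i, ∑ j, c i * c j * C (ts i) (ts j)).toNNReal : ℝ) := by
  have hm : Measurable fun ω => ∑ i, c i * X (ts i) ω :=
    Finset.measurable_sum _ fun i _ => (hX.1 _).const_mul _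
  have e := integral_map (μ := P) hm.aemeasurable (f := fun x : ℝ => x ^ 2) (by fun_prop)
  have v := variance_eq_sub (memLp_id_gaussianReal (μ := 0)
    (v := (∑ i, ∑ j, c i * c j * C (ts i) (ts j)).toNNReal) 2)
  rw [variance_id_gaussianReal] at v
  simp only [Pi.pow_apply, id, integral_id_gaussianReal] at v
  rw [← e, hX.2, v]
  simp

lemma covH_self {H : ℝ} (hH0 : 0 < H) (s : ℝ) : covH H s s = |s| ^ (2 * H) := by
  simp [covH, Real.zero_rpow (by positivity : 2 * H ≠ 0)]

lemma covH_comm (H s t : ℝ) : covH H s t = covH H t s := by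
  rw [covH, covH, abs_sub_comm s t]
  ring

lemma IsCenteredGaussianProcess.integral_mul_eq_covH {H : ℝ} (hH0 : 0 < H)
    (hX : IsCenteredGaussianProcess P X (covH H)) (s t : ℝ) :
    ∫ ω, X s ω * X t ω ∂P = covH H s t := by
  have sq_one : ∀ s, ∫ ω, X s ω ^ 2 ∂P = covH H s s := by
    intro s
    have h := hX.integral_sq_linear (fun _ : Fin 1 => s) fun _ => 1
    simp only [Finset.univ_unique, Finset.sum_singleton, one_mul] at h
    rw [h, covH_self hH0, Real.coe_toNNReal _ (by positivity)]
  have h := hX.integral_sq_linear ![s, t] ![1, -1]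
  simp only [Fin.sum_univ_two, Matrix.cons_val_zero, Matrix.cons_val_one] at h
  have e : 1 * 1 * covH H s s + 1 * -1 * covH H s t +
      (-1 * 1 * covH H t s + -1 * -1 * covH H t t) = |s - t| ^ (2 * H) := by
    rw [covH_self hH0, covH_self hH0, covH_comm H t s, covH]
    ring
  rw [e, Real.coe_toNNReal _ (by positivity)] at h
  have hs := (hX.memLp s).integrable_sq
  have ht := (hX.memLp t).integrable_sq
  have hst := (hX.memLp s).integrable_mul (hX.memLp t)
  have e1 : ∫ ω, (1 * X s ω + -1 * X t ω) ^ 2 ∂P =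
      ∫ ω, (X s ω ^ 2 + X t ω ^ 2 - 2 * (X s ω * X t ω)) ∂P := by
    congr 1
    ext ω
    ring
  have e2 : ∫ ω, (X s ω ^ 2 + X t ω ^ 2) ∂P = _ := integral_add hs ht
  have e3 : ∫ ω, (X s ω ^ 2 + X t ω ^ 2 - 2 * (X s ω * X t ω)) ∂P = _ :=
    integral_sub (hs.add ht) (hst.const_mul 2)
  rw [e1, e3] at h
  have e4 : ∫ ω, 2 * (X s ω * X t ω) ∂P = 2 * ∫ ω, X s ω * X t ω ∂P := integral_const_mul _ _
  rw [e4, e2, sq_one, sq_one, covH_self hH0, covH_self hH0] at h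
  rw [covH]
  linarith

end GaussianProcess

/-- The average of the process over the endpoints of a dyadic interval. -/
def Xavg (X : ℝ → Ω → ℝ) (n j : ℕ) (ω : Ω) : ℝ :=
  (X (dyadicPt n (j + 1)) ω + X (dyadicPt n j) ω) / 2

/-- The dyadic mesh `2^{−n/2}`. -/
def mesh (n : ℕ) : ℝ := (2 : ℝ) ^ (-(n : ℝ) / 2)

/-- The increments over two dyadic intervals, normalized to unit variance, together with the
averages over these intervals. -/
def incrVec (H : ℝ) (X : ℝ → Ω → ℝ) (n j l : ℕ) (k : Fin 4) (ω : Ω) : ℝ :=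
  ![mesh n ^ (-H) * Xincr X n j ω, mesh n ^ (-H) * Xincr X n l ω, Xavg X n j ω, Xavg X n l ω] k

lemma exists_incrVec_eq (Ω : Type*) (H : ℝ) (n j l : ℕ) : ∃ (ts : Fin 4 → ℝ) (L : (Fin 4 → ℝ) →L[ℝ] Fin 4 → ℝ),
    ∀ (X : ℝ → Ω → ℝ) (ω : Ω), (fun k => incrVec H X n j l k ω) = L fun i => X (ts i) ω := by
  let L : (Fin 4 → ℝ) →ₗ[ℝ] (Fin 4 → ℝ) :=
    { toFun := fun z => ![mesh n ^ (-H) * (z 0 - z 1), mesh n ^ (-H) * (z 2 - z 3),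
        (z 0 + z 1) / 2, (z 2 + z 3) / 2]
      map_add' := by
        intro x y
        ext k
        fin_cases k <;> simp <;> ring
      map_smul' := by
        intro x y
        ext k
        fin_cases k <;> simp <;> ring }
  refine ⟨![dyadicPt n (j + 1), dyadicPt n j, dyadicPt n (l + 1), dyadicPt n l],
    LinearMap.toContinuousLinearMap L, fun X ω => ?_⟩
  ext k
  fin_cases k <;> simp [incrVec, L, Xincr, Xavg]

section Increments

variable [MeasurableSpace Ω] {P : Measure Ω} {X : ℝ → Ω → ℝ} {H : ℝ}

lemma mesh_pos (n : ℕ) : 0 < mesh n := Real.rpow_pos_of_pos two_pos _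

lemma mesh_le_one (n : ℕ) : mesh n ≤ 1 :=
  Real.rpow_le_one_of_one_le_of_nonpos one_le_two (by
    have : (0 : ℝ) ≤ n := n.cast_nonneg
    linarith)

lemma covH_mul_mul {d : ℝ} (hd : 0 < d) (H a b : ℝ) :
    covH H (a * d) (b * d) = d ^ (2 * H) * covH H a b := by
  simp only [covH, ← sub_mul, abs_mul, abs_of_pos hd]
  rw [Real.mul_rpow (abs_nonneg _) hd.le, Real.mul_rpow (abs_nonneg _) hd.le,
    Real.mul_rpow (abs_nonneg _) hd.le]
  ring

lemma integral_linear_mul_linear (hH0 : 0 < H) (hX : IsCenteredGaussianProcess P X (covH H))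
    (s t u v a b c d : ℝ) :
    ∫ ω, (a * X s ω + b * X t ω) * (c * X u ω + d * X v ω) ∂P =
      a * c * covH H s u + a * d * covH H s v + b * c * covH H t u + b * d * covH H t v := by
  have I := fun (α s t : ℝ) => ((hX.memLp s).integrable_mul (hX.memLp t)).const_mul α
  have e : ∫ ω, (a * X s ω + b * X t ω) * (c * X u ω + d * X v ω) ∂P =
      ∫ ω, (a * c * (X s ω * X u ω) + a * d * (X s ω * X v ω) + b * c * (X t ω * X u ω) +
        b * d * (X t ω * X v ω)) ∂P := by
    congr 1
    ext ω
    ring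
  have e4 := integral_add_four (I (a * c) s u) (I (a * d) s v) (I (b * c) t u) (I (b * d) t v)
  simp only [Pi.mul_apply, integral_const_mul] at e4
  rw [e, e4]
  simp only [hX.integral_mul_eq_covH hH0]

lemma integral_Xincr_mul_Xincr (hH0 : 0 < H) (hX : IsCenteredGaussianProcess P X (covH H))
    (n j l : ℕ) :
    ∫ ω, Xincr X n j ω * Xincr X n l ω ∂P = mesh n ^ (2 * H) * rhoH H ((j : ℤ) - l) := by
  have h := integral_linear_mul_linear hH0 hX (dyadicPt n (j + 1)) (dyadicPt n j)
    (dyadicPt n (l + 1)) (dyadicPt n l) 1 (-1) 1 (-1)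
  simp only [dyadicPt, ← mesh.eq_def, covH_mul_mul (mesh_pos n)] at h
  calc _ = _ := by
        congr 1
        ext ω
        simp only [Xincr, dyadicPt, ← mesh.eq_def]
        ring
    _ = _ := h
    _ = _ := by
        simp only [covH, rhoH]
        push_cast
        rw [show (j : ℝ) + 1 - (l + 1) = j - l by ring,
          show (j : ℝ) + 1 - l = j - l + 1 by ring, show (j : ℝ) - (l + 1) = j - l - 1 by ring]
        ring

lemma integral_Xincr_mul_Xavg (hH0 : 0 < H) (hX : IsCenteredGaussianProcess P X (covH H))
    (n j l : ℕ) :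
    ∫ ω, Xincr X n j ω * Xavg X n l ω ∂P = mesh n ^ (2 * H) * incrMidCov H j l := by
  have h := integral_linear_mul_linear hH0 hX (dyadicPt n (j + 1)) (dyadicPt n j)
    (dyadicPt n (l + 1)) (dyadicPt n l) 1 (-1) (1 / 2) (1 / 2)
  simp only [dyadicPt, ← mesh.eq_def, covH_mul_mul (mesh_pos n)] at h
  calc _ = _ := by
        congr 1
        ext ω
        simp only [Xincr, Xavg, dyadicPt, ← mesh.eq_def]
        ring
    _ = _ := h
    _ = _ := by
        simp only [incrMidCov]
        push_cast
        ring

lemma hasGaussianLaw_incrVec {C : ℝ → ℝ → ℝ} (hX : IsCenteredGaussianProcess P X C) (n j l : ℕ) :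
    HasGaussianLaw (fun ω k => incrVec H X n j l k ω) P := by
  obtain ⟨ts, L, h⟩ := exists_incrVec_eq Ω H n j l
  rw [show (fun ω k => incrVec H X n j l k ω) = _ from funext (h X)]
  exact (hX.hasGaussianLaw ts).map_fun L

lemma indepFun_incrVec {X1 X2 : ℝ → Ω → ℝ} (hInd : IndepProcesses P X1 X2) (n j l : ℕ) :
    IndepFun (fun ω k => incrVec H X1 n j l k ω) (fun ω k => incrVec H X2 n j l k ω) P := by
  obtain ⟨ts, L, h⟩ := exists_incrVec_eq Ω H n j l
  rw [show (fun ω k => incrVec H X1 n j l k ω) = _ from funext (h X1),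
    show (fun ω k => incrVec H X2 n j l k ω) = _ from funext (h X2)]
  have hle : ∀ X : ℝ → Ω → ℝ, MeasurableSpace.comap (fun ω i => X (ts i) ω) inferInstance ≤
      ⨆ t : ℝ, MeasurableSpace.comap (X t) inferInstance := by
    intro X
    refine Measurable.comap_le (m₁ := ⨆ t : ℝ, MeasurableSpace.comap (X t) inferInstance) ?_
    refine @measurable_pi_lambda _ _ _ (_) _ _ fun i => ?_
    exact (comap_measurable (X (ts i))).mono
      (le_iSup (fun t => MeasurableSpace.comap (X t) inferInstance) (ts i)) le_rfl
  have h0 : IndepFun (fun ω i => X1 (ts i) ω) (fun ω i => X2 (ts i) ω) P :=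
    (IndepFun_iff_Indep _ _ _).2
      (indep_of_indep_of_le_right (indep_of_indep_of_le_left hInd (hle X1)) (hle X2))
  exact h0.comp L.measurable L.measurable

lemma integral_incrVec {C : ℝ → ℝ → ℝ} (hX : IsCenteredGaussianProcess P X C) (n j l : ℕ)
    (k : Fin 4) : ∫ ω, incrVec H X n j l k ω ∂P = 0 := by
  have I : ∀ s, Integrable (X s) P := fun s =>
    ((hX.hasGaussianLaw fun _ : Fin 1 => s).eval 0).integrable
  have hincr : ∀ j, ∫ ω, mesh n ^ (-H) * Xincr X n j ω ∂P = 0 := fun j => by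
    simp only [Xincr]
    rw [integral_const_mul, integral_sub (I _) (I _), hX.integral_eq_zero, hX.integral_eq_zero]
    simp
  have havg : ∀ j, ∫ ω, Xavg X n j ω ∂P = 0 := fun j => by
    simp only [Xavg]
    rw [integral_div, integral_add (I _) (I _), hX.integral_eq_zero, hX.integral_eq_zero]
    simp
  fin_cases k
  · exact hincr j
  · exact hincr l
  · exact havg j
  · exact havg l

lemma rhoH_zero {H : ℝ} (hH0 : 0 < H) : rhoH H 0 = 1 := by
  simp [rhoH, Real.zero_rpow (by positivity : 2 * H ≠ 0)]

lemma mesh_rpow_mul (H : ℝ) (n : ℕ) : mesh n ^ (-H) * mesh n ^ (2 * H) = mesh n ^ H := by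
  rw [← Real.rpow_add (mesh_pos n)]
  ring_nf

lemma mesh_rpow_mul_mul (H : ℝ) (n : ℕ) :
    mesh n ^ (-H) * mesh n ^ (-H) * mesh n ^ (2 * H) = 1 := by
  rw [mul_assoc, mesh_rpow_mul, ← Real.rpow_add (mesh_pos n)]
  simp

lemma integral_scaled_Xincr_mul_Xincr (hH0 : 0 < H)
    (hX : IsCenteredGaussianProcess P X (covH H)) (n j l : ℕ) :
    ∫ ω, (mesh n ^ (-H) * Xincr X n j ω) * (mesh n ^ (-H) * Xincr X n l ω) ∂P =
      rhoH H ((j : ℤ) - l) := by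
  rw [show ∫ ω, (mesh n ^ (-H) * Xincr X n j ω) * (mesh n ^ (-H) * Xincr X n l ω) ∂P =
      ∫ ω, mesh n ^ (-H) * mesh n ^ (-H) * (Xincr X n j ω * Xincr X n l ω) ∂P by
        congr 1
        ext ω
        ring, integral_const_mul, integral_Xincr_mul_Xincr hH0 hX, ← mul_assoc, mesh_rpow_mul_mul, one_mul]

lemma integral_scaled_Xincr_mul_Xavg (hH0 : 0 < H)
    (hX : IsCenteredGaussianProcess P X (covH H)) (n j l : ℕ) :
    ∫ ω, (mesh n ^ (-H) * Xincr X n j ω) * Xavg X n l ω ∂P = mesh n ^ H * incrMidCov H j l := by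
  simp only [mul_assoc]
  rw [integral_const_mul, integral_Xincr_mul_Xavg hH0 hX, ← mul_assoc, mesh_rpow_mul]

end Increments

lemma IsCenteredGaussianProcess.integral_incrVec_sq [MeasurableSpace Ω] {P : Measure Ω} {H : ℝ}
    (hH0 : 0 < H) {X : ℝ → Ω → ℝ} (hX : IsCenteredGaussianProcess P X (covH H)) (n j l : ℕ) :
    ∫ ω, incrVec H X n j l 0 ω * incrVec H X n j l 0 ω ∂P = 1 ∧
      ∫ ω, incrVec H X n j l 1 ω * incrVec H X n j l 1 ω ∂P = 1 :=
  ⟨(integral_scaled_Xincr_mul_Xincr hH0 hX n j j).trans (by rw [sub_self, rhoH_zero hH0]),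
    (integral_scaled_Xincr_mul_Xincr hH0 hX n l l).trans (by rw [sub_self, rhoH_zero hH0])⟩

lemma exists_abs_integral_incrVec_le {H : ℝ} (hH0 : 0 < H) (hH : H < 1 / 2) [MeasurableSpace Ω]
    (K : ℝ) {q : ℕ} (hq : Odd q) :
    ∃ C : ℝ, 0 ≤ C ∧ ∀ (P : Measure Ω) (X : ℝ → Ω → ℝ) (G₁ G₂ : ℕ → ℝ → ℝ) (n j l : ℕ),
      IsCenteredGaussianProcess P X (covH H) → IsBoundedJet K G₁ → IsBoundedJet K G₂ →
      |∫ ω, incrVec H X n j l 0 ω ^ q * incrVec H X n j l 1 ω ^ q *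
          G₁ 0 (incrVec H X n j l 2 ω) * G₂ 0 (incrVec H X n j l 3 ω) ∂P| ≤
        C * (|rhoH H ((j : ℤ) - l)| + mesh n ^ (2 * H) *
          ((|incrMidCov H j j| + |incrMidCov H j l|) *
            (|incrMidCov H l j| + |incrMidCov H l l|))) := by
  obtain ⟨C, hC, key⟩ := exists_abs_mixedMoment_le_of_odd (Ω := Ω) (ι := Fin 4) K q q hq hq
  refine ⟨C, hC, fun P X G₁ G₂ n j l hX h₁ h₂ => ?_⟩
  have hs : 0 ≤ mesh n ^ H := (Real.rpow_pos_of_pos (mesh_pos n) _).le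
  have hs1 : mesh n ^ H ≤ 1 := Real.rpow_le_one (mesh_pos n).le (mesh_le_one n) hH0.le
  have hsm : ∀ j l, |mesh n ^ H * incrMidCov H j l| ≤ 1 := fun j l => by
    rw [abs_mul, abs_of_nonneg hs]
    exact mul_le_one₀ hs1 (abs_nonneg _) (abs_incrMidCov_le_one hH0 hH j l)
  have h01 : ∫ ω, incrVec H X n j l 0 ω * incrVec H X n j l 1 ω ∂P = rhoH H ((j : ℤ) - l) :=
    integral_scaled_Xincr_mul_Xincr hH0 hX n j l
  obtain ⟨h00, h11⟩ := hX.integral_incrVec_sq hH0 n j l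
  have h02 : ∫ ω, incrVec H X n j l 0 ω * incrVec H X n j l 2 ω ∂P = _ :=
    integral_scaled_Xincr_mul_Xavg hH0 hX n j j
  have h03 : ∫ ω, incrVec H X n j l 0 ω * incrVec H X n j l 3 ω ∂P = _ :=
    integral_scaled_Xincr_mul_Xavg hH0 hX n j l
  have h12 : ∫ ω, incrVec H X n j l 1 ω * incrVec H X n j l 2 ω ∂P = _ :=
    integral_scaled_Xincr_mul_Xavg hH0 hX n l j
  have h13 : ∫ ω, incrVec H X n j l 1 ω * incrVec H X n j l 3 ω ∂P = _ :=
    integral_scaled_Xincr_mul_Xavg hH0 hX n l l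
  have h := key P (incrVec H X n j l) G₁ G₂ 0 1 2 3 (hasGaussianLaw_incrVec hX n j l)
    (integral_incrVec hX n j l) h₁ h₂ h00 h11 (by rw [h02]; exact hsm j j)
    (by rw [h03]; exact hsm j l)
  rw [h01, h02, h03, h12, h13] at h
  refine h.trans_eq ?_
  simp only [abs_mul, abs_of_nonneg hs]
  rw [show mesh n ^ (2 * H) = mesh n ^ H * mesh n ^ H by
    rw [← Real.rpow_add (mesh_pos n)]; ring_nf]
  ring

lemma abs_integral_le_of_indepFun {E F : Type*} [MeasurableSpace E] [MeasurableSpace F]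
    [MeasurableSpace Ω] {P : Measure Ω} [IsProbabilityMeasure P] {U : Ω → E} {V : Ω → F}
    (hU : AEMeasurable U P) (hV : AEMeasurable V P) (hUV : IndepFun U V P) {w : E → ℝ}
    {φ : E × F → ℝ} (hw : Measurable w) (hφ : Measurable φ)
    (hwi : Integrable (fun ω => w (U ω)) P)
    (hi : Integrable (fun ω => w (U ω) * φ (U ω, V ω)) P) {B : ℝ}
    (hB : ∀ x, |∫ ω, φ (x, V ω) ∂P| ≤ B) :
    |∫ ω, w (U ω) * φ (U ω, V ω) ∂P| ≤ B * ∫ ω, |w (U ω)| ∂P := by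
  have hmap := (indepFun_iff_map_prod_eq_prod_map_map hU hV).1 hUV
  have := Measure.isProbabilityMeasure_map hU
  have := Measure.isProbabilityMeasure_map hV
  have hm : Measurable fun x : E × F => w x.1 * φ x := (hw.comp measurable_fst).mul hφ
  have hI : Integrable (fun x : E × F => w x.1 * φ x) ((P.map U).prod (P.map V)) := by
    rw [← hmap]
    exact (integrable_map_measure hm.aestronglyMeasurable (hU.prodMk hV)).2 hi
  have e : ∫ ω, w (U ω) * φ (U ω, V ω) ∂P =
      ∫ x, w x * ∫ ω, φ (x, V ω) ∂P ∂(P.map U) := by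
    rw [← integral_map (hU.prodMk hV) (f := fun x : E × F => w x.1 * φ x) hm.aestronglyMeasurable,
      hmap, integral_prod _ hI]
    congr 1
    ext x
    dsimp only
    rw [integral_const_mul, integral_map hV (f := fun y => φ (x, y))
      (hφ.comp measurable_prodMk_left).aestronglyMeasurable]
  have e2 : ∫ ω, |w (U ω)| ∂P = ∫ x, |w x| ∂(P.map U) :=
    (integral_map hU (f := fun x => |w x|) hw.abs.aestronglyMeasurable).symm
  rw [e, e2, ← integral_const_mul, ← Real.norm_eq_abs]
  refine norm_integral_le_of_norm_le (Integrable.const_mul ?_ B)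
    (Eventually.of_forall fun x => ?_)
  · exact ((integrable_map_measure hw.aestronglyMeasurable hU).2 hwi).abs
  · rw [Real.norm_eq_abs, abs_mul, mul_comm]
    exact mul_le_mul_of_nonneg_right (hB x) (abs_nonneg _)

/-- The summand of the weighted power variation. -/
def variationTerm (X1 X2 : ℝ → Ω → ℝ) (f : ℝ → ℝ → ℝ) (p q n j : ℕ) (ω : Ω) : ℝ :=
  Xmid X1 X2 f n j ω * Xincr X1 n j ω ^ p * Xincr X2 n j ω ^ q

lemma variationTerm_mul (H : ℝ) (X1 X2 : ℝ → Ω → ℝ) (f : ℝ → ℝ → ℝ) (p q n j l : ℕ) (ω : Ω) :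
    variationTerm X1 X2 f p q n j ω * variationTerm X1 X2 f p q n l ω =
      (mesh n ^ H) ^ (2 * (p + q)) *
        ((incrVec H X1 n j l 0 ω ^ p * incrVec H X1 n j l 1 ω ^ p) *
          (incrVec H X2 n j l 0 ω ^ q * incrVec H X2 n j l 1 ω ^ q *
            f (incrVec H X1 n j l 2 ω) (incrVec H X2 n j l 2 ω) *
            f (incrVec H X1 n j l 3 ω) (incrVec H X2 n j l 3 ω))) := by
  have hs : mesh n ^ H * mesh n ^ (-H) = 1 := by
    rw [← Real.rpow_add (mesh_pos n)]
    simp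
  have hx : ∀ (X : ℝ → Ω → ℝ) j, Xincr X n j ω = mesh n ^ H * (mesh n ^ (-H) * Xincr X n j ω) :=
    fun X j => by rw [← mul_assoc, hs, one_mul]
  have h0 : ∀ X : ℝ → Ω → ℝ, Xincr X n j ω = mesh n ^ H * incrVec H X n j l 0 ω := fun X => hx X j
  have h1 : ∀ X : ℝ → Ω → ℝ, Xincr X n l ω = mesh n ^ H * incrVec H X n j l 1 ω := fun X => hx X l
  have hj : Xmid X1 X2 f n j ω = f (incrVec H X1 n j l 2 ω) (incrVec H X2 n j l 2 ω) := rfl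
  have hl : Xmid X1 X2 f n l ω = f (incrVec H X1 n j l 3 ω) (incrVec H X2 n j l 3 ω) := rfl
  simp only [variationTerm, h0, h1, hj, hl, mul_pow]
  ring

section VariationTerm

variable [MeasurableSpace Ω] {P : Measure Ω} {H : ℝ} {X1 X2 : ℝ → Ω → ℝ} {f : ℝ → ℝ → ℝ}

lemma memLp_variationTerm {C₁ C₂ : ℝ → ℝ → ℝ} (hX1 : IsCenteredGaussianProcess P X1 C₁)
    (hX2 : IsCenteredGaussianProcess P X2 C₂) (hf : CbSmooth2 f) (p q n j : ℕ) :
    MemLp (variationTerm X1 X2 f p q n j) 2 P := by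
  obtain ⟨M, hM⟩ := hf.2 0
  have hM' : ∀ x y, |f x y| ≤ M := fun x y => by simpa using hM (x, y)
  have hfm : Measurable fun x : ℝ × ℝ => f x.1 x.2 := (hf.1 0).continuous.measurable
  have hincr : ∀ {X : ℝ → Ω → ℝ} {C : ℝ → ℝ → ℝ}, IsCenteredGaussianProcess P X C → ∀ a,
      Integrable (fun ω => Xincr X n j ω ^ a) P ∧ Measurable (Xincr X n j) := by
    intro X C hX a
    have h := (hX.hasGaussianLaw ![dyadicPt n (j + 1), dyadicPt n j]).map_fun
      (ContinuousLinearMap.proj (R := ℝ) (φ := fun _ : Fin 2 => ℝ) 0 -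
        ContinuousLinearMap.proj (R := ℝ) (φ := fun _ : Fin 2 => ℝ) 1)
    exact ⟨integrable_pow_of_hasGaussianLaw h a, (hX.1 _).sub (hX.1 _)⟩
  have hmid : Measurable (Xmid X1 X2 f n j) :=
    hfm.comp ((((hX1.1 _).add (hX1.1 _)).div_const 2).prodMk
      (((hX2.1 _).add (hX2.1 _)).div_const 2))
  have hmeas : Measurable (variationTerm X1 X2 f p q n j) :=
    (hmid.mul ((hincr hX1 0).2.pow_const p)).mul ((hincr hX2 0).2.pow_const q)
  rw [memLp_two_iff_integrable_sq hmeas.aestronglyMeasurable]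
  refine ((((hincr hX1 (2 * (2 * p))).1).add ((hincr hX2 (2 * (2 * q))).1)).const_mul
    (M ^ 2)).mono' (hmeas.pow_const 2).aestronglyMeasurable (Eventually.of_forall fun ω => ?_)
  have h1 := abs_pow_mul_pow_le (Xincr X1 n j ω) (Xincr X2 n j ω) (2 * p) (2 * q)
  have h2 : Xmid X1 X2 f n j ω ^ 2 ≤ M ^ 2 := sq_le_sq' (neg_le_of_abs_le (hM' _ _))
    (le_of_abs_le (hM' _ _))
  rw [Real.norm_eq_abs, variationTerm, mul_assoc, mul_pow, abs_mul, abs_of_nonneg (sq_nonneg _),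
    mul_pow, ← pow_mul, ← pow_mul, mul_comm p, mul_comm q]
  exact mul_le_mul h2 h1 (abs_nonneg _) (sq_nonneg M)

lemma exists_integral_variationTerm_mul_le [IsProbabilityMeasure P] (hH0 : 0 < H) (hH : H < 1 / 2)
    (hX1 : IsCenteredGaussianProcess P X1 (covH H))
    (hX2 : IsCenteredGaussianProcess P X2 (covH H)) (hInd : IndepProcesses P X1 X2)
    (hf : CbSmooth2 f) (p : ℕ) {q : ℕ} (hq : Odd q) :
    ∃ C : ℝ, 0 ≤ C ∧ ∀ n j l : ℕ,
      ∫ ω, variationTerm X1 X2 f p q n j ω * variationTerm X1 X2 f p q n l ω ∂P ≤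
        C * (mesh n ^ H) ^ (2 * (p + q)) *
          (|rhoH H ((j : ℤ) - l)| + mesh n ^ (2 * H) *
            ((|incrMidCov H j j| + |incrMidCov H j l|) *
              (|incrMidCov H l j| + |incrMidCov H l l|))) := by
  obtain ⟨K, hK⟩ := exists_isBoundedJet hf
  obtain ⟨C, hC, key⟩ := exists_abs_integral_incrVec_le (Ω := Ω) hH0 hH K hq
  refine ⟨C * (2 * stdMoment p), mul_nonneg hC (mul_nonneg two_pos.le (stdMoment_nonneg p)),
    fun n j l => ?_⟩
  set R := |rhoH H ((j : ℤ) - l)| + mesh n ^ (2 * H) *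
    ((|incrMidCov H j j| + |incrMidCov H j l|) * (|incrMidCov H l j| + |incrMidCov H l l|))
  have hR : 0 ≤ R := by
    have := mesh_pos n
    positivity
  have hs : 0 < mesh n ^ H := Real.rpow_pos_of_pos (mesh_pos n) _
  have hG1 := hasGaussianLaw_incrVec (H := H) hX1 n j l
  have hG2 := hasGaussianLaw_incrVec (H := H) hX2 n j l
  have hfm : Measurable fun x : ℝ × ℝ => f x.1 x.2 := (hf.1 0).continuous.measurable
  set w : (Fin 4 → ℝ) → ℝ := fun z => z 0 ^ p * z 1 ^ p with hw
  set φ : (Fin 4 → ℝ) × (Fin 4 → ℝ) → ℝ := fun x =>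
    x.2 0 ^ q * x.2 1 ^ q * f (x.1 2) (x.2 2) * f (x.1 3) (x.2 3) with hφ
  have hwm : Measurable w := by fun_prop
  have hφm : Measurable φ := by
    have m : ∀ k : Fin 4, Measurable fun x : (Fin 4 → ℝ) × (Fin 4 → ℝ) => f (x.1 k) (x.2 k) :=
      fun k => hfm.comp (f := fun x : (Fin 4 → ℝ) × (Fin 4 → ℝ) => (x.1 k, x.2 k)) (by fun_prop)
    exact (Measurable.mul (by fun_prop) (m 2)).mul (m 3)
  have hprod : Integrable (fun ω => variationTerm X1 X2 f p q n j ω *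
      variationTerm X1 X2 f p q n l ω) P :=
    (memLp_variationTerm hX1 hX2 hf p q n j).integrable_mul
      (memLp_variationTerm hX1 hX2 hf p q n l)
  simp only [variationTerm_mul H] at hprod ⊢
  have hi := (integrable_const_mul_iff (pow_pos hs _).ne'.isUnit _).1 hprod
  obtain ⟨v0, v1⟩ := hX1.integral_incrVec_sq hH0 n j l
  have i0 := integrable_pow_of_hasGaussianLaw (hG1.eval 0) (2 * p)
  have i1 := integrable_pow_of_hasGaussianLaw (hG1.eval 1) (2 * p)
  have hdom : ∀ ω, |w fun k => incrVec H X1 n j l k ω| ≤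
      incrVec H X1 n j l 0 ω ^ (2 * p) + incrVec H X1 n j l 1 ω ^ (2 * p) :=
    fun ω => abs_pow_mul_pow_le _ _ _ _
  have hwi : Integrable (fun ω => w fun k => incrVec H X1 n j l k ω) P :=
    (i0.add i1).mono' (hwm.comp_aemeasurable hG1.aemeasurable).aestronglyMeasurable
      (Eventually.of_forall hdom)
  have hwb : ∫ ω, |w fun k => incrVec H X1 n j l k ω| ∂P ≤ 2 * stdMoment p := by
    refine (integral_mono hwi.abs (i0.add i1) hdom).trans_eq ?_
    have e : ∫ ω, (incrVec H X1 n j l 0 ω ^ (2 * p) + incrVec H X1 n j l 1 ω ^ (2 * p)) ∂P = _ :=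
      integral_add i0 i1
    rw [integral_pow_eq_stdMoment (hG1.eval 0) (integral_incrVec hX1 n j l 0) v0,
      integral_pow_eq_stdMoment (hG1.eval 1) (integral_incrVec hX1 n j l 1) v1] at e
    exact e.trans (two_mul _).symm
  have hb := abs_integral_le_of_indepFun hG1.aemeasurable hG2.aemeasurable
    (indepFun_incrVec hInd n j l) hwm hφm hwi hi (B := C * R) (fun x => by
      have := key P X2 _ _ n j l hX2 (hK (x 2)) (hK (x 3))
      simpa only [iteratedDeriv_zero] using this)
  rw [integral_const_mul]
  calc _ ≤ (mesh n ^ H) ^ (2 * (p + q)) * (C * R * (2 * stdMoment p)) := by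
        refine mul_le_mul_of_nonneg_left ?_ (pow_nonneg hs.le _)
        exact (le_abs_self _).trans (hb.trans
          (mul_le_mul_of_nonneg_left hwb (mul_nonneg hC hR)))
    _ = _ := by ring

lemma integral_sq_sum_variationTerm {C₁ C₂ : ℝ → ℝ → ℝ} (hX1 : IsCenteredGaussianProcess P X1 C₁)
    (hX2 : IsCenteredGaussianProcess P X2 C₂) (hf : CbSmooth2 f) (p q n N : ℕ) :
    ∫ ω, (∑ j ∈ Finset.range N, variationTerm X1 X2 f p q n j ω) ^ 2 ∂P =
      ∑ j ∈ Finset.range N, ∑ l ∈ Finset.range N,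
        ∫ ω, variationTerm X1 X2 f p q n j ω * variationTerm X1 X2 f p q n l ω ∂P := by
  have I : ∀ j l, Integrable (fun ω => variationTerm X1 X2 f p q n j ω *
      variationTerm X1 X2 f p q n l ω) P := fun j l =>
    (memLp_variationTerm hX1 hX2 hf p q n j).integrable_mul
      (memLp_variationTerm hX1 hX2 hf p q n l)
  simp only [sq, Finset.sum_mul_sum]
  rw [integral_finsetSum _ fun j _ => integrable_finsetSum _ fun l _ => I j l]
  exact Finset.sum_congr rfl fun j _ => integral_finsetSum _ fun l _ => I j l

end VariationTerm

lemma nSteps_mul_mesh_le {t : ℝ} (ht : 0 ≤ t) (n : ℕ) : nSteps n t * mesh n ≤ t := by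
  have h1 : (nSteps n t : ℝ) ≤ (2 : ℝ) ^ ((n : ℝ) / 2) * t := Nat.floor_le (by positivity)
  have h2 : (2 : ℝ) ^ ((n : ℝ) / 2) * mesh n = 1 := by
    rw [mesh, ← Real.rpow_add two_pos, neg_div, add_neg_cancel, Real.rpow_zero]
  calc _ ≤ (2 : ℝ) ^ ((n : ℝ) / 2) * t * mesh n :=
        mul_le_mul_of_nonneg_right h1 (mesh_pos n).le
    _ = t := by rw [mul_right_comm, h2, one_mul]

lemma mesh_pow_mul_nSteps_le {H t : ℝ} (hH0 : 0 < H) (ht : 0 ≤ t) (p q n : ℕ) :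
    (mesh n ^ H) ^ (2 * (p + q)) * (nSteps n t * (3 + 6 * (mesh n ^ (2 * H) *
      (nSteps n t : ℝ) ^ (2 * H)))) ≤
      6 * ((2 : ℝ) ^ (-(n : ℝ) * (H * ((p : ℝ) + q) - 1 / 2)) * (t + t ^ (2 * H + 1))) := by
  have hd := mesh_pos n
  have hN := nSteps_mul_mesh_le ht n
  have e1 : mesh n ^ (2 * H) * (nSteps n t : ℝ) ^ (2 * H) ≤ t ^ (2 * H) := by
    rw [mul_comm, ← Real.mul_rpow (Nat.cast_nonneg _) hd.le]
    exact Real.rpow_le_rpow (by positivity) hN (by positivity)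
  have e2 : (2 : ℝ) ^ (-(n : ℝ) * (H * ((p : ℝ) + q) - 1 / 2)) * mesh n =
      (mesh n ^ H) ^ (2 * (p + q)) := by
    rw [← Real.rpow_mul_natCast hd.le, mesh, ← Real.rpow_add two_pos, ← Real.rpow_mul two_pos.le]
    push_cast
    ring_nf
  have e3 : t ^ (2 * H + 1) = t ^ (2 * H) * t := Real.rpow_add_one' ht (by positivity)
  rw [← e2, e3]
  set A := (2 : ℝ) ^ (-(n : ℝ) * (H * ((p : ℝ) + q) - 1 / 2))
  have hA : 0 ≤ A := Real.rpow_nonneg two_pos.le _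
  have hT : 0 ≤ t ^ (2 * H) := Real.rpow_nonneg ht _
  calc _ = A * ((nSteps n t * mesh n) * (3 + 6 * (mesh n ^ (2 * H) *
        (nSteps n t : ℝ) ^ (2 * H)))) := by ring
    _ ≤ A * (t * (3 + 6 * t ^ (2 * H))) := by gcongr
    _ ≤ A * (t * (6 + 6 * t ^ (2 * H))) := by gcongr; norm_num
    _ = _ := by ring

theorem weighted_power_variation_L2_bound
    {Ω : Type*} [MeasurableSpace Ω] (P : Measure Ω) [IsProbabilityMeasure P]
    (H : ℝ) (hH0 : 0 < H) (hH : H < 1 / 2)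
    (X1 X2 : ℝ → Ω → ℝ)
    (hX1 : IsCenteredGaussianProcess P X1 (covH H))
    (hX2 : IsCenteredGaussianProcess P X2 (covH H))
    (hInd : IndepProcesses P X1 X2)
    (f : ℝ → ℝ → ℝ) (hf : CbSmooth2 f)
    (p q : ℕ) (hp : Even p) (hq : Odd q) (hq1 : 1 ≤ q) :
    ∃ C : ℝ, 0 < C ∧ ∀ t : ℝ, 0 ≤ t → ∀ n : ℕ, 1 ≤ n →
      (∫ ω, (∑ j ∈ Finset.range (nSteps n t),
          (Xmid X1 X2 f n j ω * Xincr X1 n j ω ^ p * Xincr X2 n j ω ^ q)) ^ 2 ∂P) ≤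
        C * ∑ k ∈ Finset.range ((q + 1) / 2),
          ((∑ a ∈ Finset.range (2 * k + 1),
              (2 : ℝ) ^ (-(n : ℝ) *
                (H * ((p : ℝ) + (q : ℝ) + 2 * ((k : ℝ) + 1) - 1 - ((a : ℝ) + 1)) - 1 / 2))) * t +
            (2 : ℝ) ^ (-(n : ℝ) *
              (H * ((p : ℝ) + (q : ℝ) + 2 * ((k : ℝ) + 1) - 2) - 1 / 2)) * t ^ (2 * H + 1) +
            (2 : ℝ) ^ (-(n : ℝ) * H * ((p : ℝ) + (q : ℝ) + 2 * ((k : ℝ) + 1) - 1))) := by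
  obtain ⟨C, hC, hpair⟩ := exists_integral_variationTerm_mul_le hH0 hH hX1 hX2 hInd hf p hq
  refine ⟨6 * C + 1, by linarith, fun t ht n _ => ?_⟩
  set A : ℝ := (2 : ℝ) ^ (-(n : ℝ) * (H * ((p : ℝ) + q) - 1 / 2)) with hA
  have hA0 : 0 ≤ A * (t + t ^ (2 * H + 1)) := by positivity
  have hle : A * (t + t ^ (2 * H + 1)) ≤ _ :=
    le_trans ?_ (Finset.single_le_sum (f := fun k : ℕ =>
      (∑ a ∈ Finset.range (2 * k + 1),
        (2 : ℝ) ^ (-(n : ℝ) *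
          (H * ((p : ℝ) + (q : ℝ) + 2 * ((k : ℝ) + 1) - 1 - ((a : ℝ) + 1)) - 1 / 2))) * t +
        (2 : ℝ) ^ (-(n : ℝ) *
          (H * ((p : ℝ) + (q : ℝ) + 2 * ((k : ℝ) + 1) - 2) - 1 / 2)) * t ^ (2 * H + 1) +
        (2 : ℝ) ^ (-(n : ℝ) * H * ((p : ℝ) + (q : ℝ) + 2 * ((k : ℝ) + 1) - 1)))
      (fun k _ => by positivity)
      (Finset.mem_range.2 (show 0 < (q + 1) / 2 by omega)))
  · refine le_trans ?_ (mul_le_mul_of_nonneg_left hle (by linarith))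
    have hsum := sum_sum_covariances_le hH0 hH (nSteps n t)
      (Real.rpow_nonneg (mesh_pos n).le (2 * H))
    have hs : 0 ≤ (mesh n ^ H) ^ (2 * (p + q)) :=
      pow_nonneg (Real.rpow_nonneg (mesh_pos n).le _) _
    calc _ = _ := integral_sq_sum_variationTerm hX1 hX2 hf p q n (nSteps n t)
      _ ≤ _ := Finset.sum_le_sum fun j _ => Finset.sum_le_sum fun l _ => hpair n j l
      _ ≤ C * ((mesh n ^ H) ^ (2 * (p + q)) * (nSteps n t * (3 + 6 * (mesh n ^ (2 * H) *
          (nSteps n t : ℝ) ^ (2 * H))))) := by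
        simp only [← Finset.mul_sum]
        rw [mul_assoc]
        gcongr
      _ ≤ C * (6 * (A * (t + t ^ (2 * H + 1)))) :=
        mul_le_mul_of_nonneg_left (mesh_pow_mul_nSteps_le hH0 ht p q n) hC
      _ ≤ _ := by linarith
  · refine le_trans (le_of_eq ?_) (le_add_of_nonneg_right (by positivity))
    simp only [mul_zero, zero_add, Finset.sum_range_one, Nat.cast_zero, hA]
    ring_nf

end
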